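/- Let u : [0,1] → ℝ be convex and continuous and let N ≥ 1. Then there exist cutoffs 0 = s₀ < s₁ < … < s_N = 1 such that the associated interval-partitional measure G* = Σ_{k=1}^{N} ν((s_{k−1}, s_k]) · δ_{φ(s_{k−1}, s_k)} satisfies ∫ u dG ≤ ∫ u dG* for every probability measure G on [0,1] that is a mean-preserving contraction of ν and whose support contains at most N points. In particular, the constrained information design problem with a convex value function is solved by an interval-partitional information structure using exactly N intervals. -/

import Mathlib

open MeasureTheory Set

/-- The mean of the density `f` conditional on the interval `(a, b)`. -/
noncomputable def condMean (g : ℝ → ℝ) (a b : ℝ) : ℝ :=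
  (∫ t in a..b, t * g t) / (∫ t in a..b, g t)

/-- The probability measure on `[0,1]` with density `f`. -/
noncomputable def densityMeasure (f : ℝ → ℝ) : Measure ℝ :=
  (volume.restrict (Icc (0:ℝ) 1)).withDensity fun t => ENNReal.ofReal (f t)

/-- `G` is a mean-preserving contraction of `ν`: it has the same mean and its
integral distribution function lies below that of `ν`. -/
def IsMPCof (ν G : Measure ℝ) : Prop :=
  (∫ t, t ∂G) = (∫ t, t ∂ν) ∧
    ∀ x ∈ Icc (0:ℝ) 1,
      (∫ t in (0:ℝ)..x, (G (Iic t)).toReal) ≤ ∫ t in (0:ℝ)..x, (ν (Iic t)).toReal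

/-- The support of `G` contains at most `N` points. -/
def FiniteSupportLE (G : Measure ℝ) (N : ℕ) : Prop :=
  ∃ S : Finset ℝ, S.card ≤ N ∧ G ((↑S : Set ℝ)ᶜ) = 0

/-- The interval-partitional measure associated with cutoffs `s 0 < s 1 < … < s N`:
`Σ_{k=1}^{N} ν((s (k-1), s k]) • δ_{φ(s (k-1), s k)}`. -/
noncomputable def intervalPartitionMeasure (f : ℝ → ℝ) (N : ℕ) (s : ℕ → ℝ) : Measure ℝ :=
  Measure.sum fun k : Fin N =>
    (densityMeasure f (Ioc (s k.val) (s (k.val + 1)))) •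
      Measure.dirac (condMean f (s k.val) (s (k.val + 1)))


lemma M_pos {f : ℝ → ℝ} (hc : Continuous f) (hp : ∀ t ∈ Icc (0:ℝ) 1, 0 < f t) {a b : ℝ}
    (ha : 0 ≤ a) (hab : a < b) (hb : b ≤ 1) : 0 < ∫ t in a..b, f t :=
  intervalIntegral.intervalIntegral_pos_of_pos_on (hc.intervalIntegrable _ _)
    (fun x hx => hp x ⟨ha.trans hx.1.le, hx.2.le.trans hb⟩) hab

lemma condMean_mem {f : ℝ → ℝ} (hc : Continuous f) (hp : ∀ t ∈ Icc (0:ℝ) 1, 0 < f t) {a b : ℝ}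
    (ha : 0 ≤ a) (hab : a < b) (hb : b ≤ 1) : condMean f a b ∈ Icc a b := by
  have hM := M_pos hc hp ha hab hb
  unfold condMean
  constructor
  · rw [le_div_iff₀ hM, ← intervalIntegral.integral_const_mul]
    apply intervalIntegral.integral_mono_on hab.le
    · exact (by fun_prop : Continuous fun t => a * f t).intervalIntegrable _ _
    · exact (by fun_prop : Continuous fun t => t * f t).intervalIntegrable _ _
    · intro x hx
      exact mul_le_mul_of_nonneg_right hx.1 (hp x ⟨ha.trans hx.1, hx.2.trans hb⟩).le
  · rw [div_le_iff₀ hM, ← intervalIntegral.integral_const_mul]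
    apply intervalIntegral.integral_mono_on hab.le
    · exact (by fun_prop : Continuous fun t => t * f t).intervalIntegrable _ _
    · exact (by fun_prop : Continuous fun t => b * f t).intervalIntegrable _ _
    · intro x hx
      exact mul_le_mul_of_nonneg_right hx.2 (hp x ⟨ha.trans hx.1, hx.2.trans hb⟩).le

noncomputable def HH (f u : ℝ → ℝ) (a b : ℝ) : ℝ := (∫ t in a..b, f t) * u (condMean f a b)

noncomputable def WW (f u : ℝ → ℝ) (N : ℕ) (s : ℕ → ℝ) : ℝ :=
  ∑ k ∈ Finset.range N, HH f u (s k) (s (k+1))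

lemma HH_self (f u : ℝ → ℝ) (a : ℝ) : HH f u a a = 0 := by simp [HH]

lemma HH_split {f u : ℝ → ℝ} (hc : Continuous f) (hp : ∀ t ∈ Icc (0:ℝ) 1, 0 < f t)
    (hu : ConvexOn ℝ (Icc (0:ℝ) 1) u) {a c b : ℝ}
    (ha : 0 ≤ a) (hac : a < c) (hcb : c < b) (hb : b ≤ 1) :
    HH f u a b ≤ HH f u a c + HH f u c b := by
  have h1 := M_pos hc hp ha hac (hcb.le.trans hb)
  have h2 := M_pos hc hp (ha.trans hac.le) hcb hb
  have m1 := condMean_mem hc hp ha hac (hcb.le.trans hb)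
  have m2 := condMean_mem hc hp (ha.trans hac.le) hcb hb
  have e1 : ∫ t in a..b, f t = (∫ t in a..c, f t) + ∫ t in c..b, f t :=
    (intervalIntegral.integral_add_adjacent_intervals (hc.intervalIntegrable _ _)
      (hc.intervalIntegrable _ _)).symm
  have hc' : Continuous fun t => t * f t := by fun_prop
  have e2 : ∫ t in a..b, t * f t = (∫ t in a..c, t * f t) + ∫ t in c..b, t * f t :=
    (intervalIntegral.integral_add_adjacent_intervals (hc'.intervalIntegrable _ _)
      (hc'.intervalIntegrable _ _)).symm
  unfold HH
  have hm : condMean f a b = ((∫ t in a..c, f t) / (∫ t in a..b, f t)) • condMean f a c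
      + ((∫ t in c..b, f t) / (∫ t in a..b, f t)) • condMean f c b := by
    simp only [condMean, e1, e2, smul_eq_mul]
    field_simp
  have hpos : 0 < ∫ t in a..b, f t := by rw [e1]; positivity
  have := hu.2 (show condMean f a c ∈ Icc (0:ℝ) 1 from ⟨ha.trans m1.1, m1.2.trans (hcb.le.trans hb)⟩)
    (show condMean f c b ∈ Icc (0:ℝ) 1 from ⟨(ha.trans hac.le).trans m2.1, m2.2.trans hb⟩)
    (show 0 ≤ (∫ t in a..c, f t) / (∫ t in a..b, f t) by positivity)
    (show 0 ≤ (∫ t in c..b, f t) / (∫ t in a..b, f t) by positivity)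
    (by rw [← add_div, ← e1, div_self hpos.ne'])
  rw [← hm, smul_eq_mul, smul_eq_mul] at this
  calc _ ≤ (∫ t in a..b, f t) * _ := mul_le_mul_of_nonneg_left this hpos.le
    _ = _ := by field_simp

lemma HH_cont {f u : ℝ → ℝ} (hc : Continuous f) (hu : Continuous u) {C : ℝ}
    (hC : ∀ t, |u t| ≤ C) : Continuous fun p : ℝ × ℝ => HH f u p.1 p.2 := by
  have hc' : Continuous fun t => t * f t := by fun_prop
  have cm : ∀ g : ℝ → ℝ, Continuous g → Continuous fun p : ℝ × ℝ => ∫ t in p.1..p.2, g t := by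
    intro g hg
    have h := intervalIntegral.continuous_primitive (μ := volume) (fun a b => hg.intervalIntegrable a b) 0
    have : (fun p : ℝ × ℝ => ∫ t in p.1..p.2, g t)
        = fun p => (∫ t in (0:ℝ)..p.2, g t) - ∫ t in (0:ℝ)..p.1, g t := by
      ext p
      rw [intervalIntegral.integral_interval_sub_left (hg.intervalIntegrable _ _)
        (hg.intervalIntegrable _ _)]
    rw [this]
    exact (h.comp continuous_snd).sub (h.comp continuous_fst)
  have c1 := cm f hc
  have c2 := cm _ hc'
  rw [continuous_iff_continuousAt]
  intro p
  by_cases h0 : ∫ t in p.1..p.2, f t = 0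
  · have hz : HH f u p.1 p.2 = 0 := by simp [HH, h0]
    rw [ContinuousAt, hz]
    apply squeeze_zero_norm (a := fun p : ℝ × ℝ => |∫ t in p.1..p.2, f t| * C)
    · intro q
      rw [HH, Real.norm_eq_abs, abs_mul]
      exact mul_le_mul_of_nonneg_left (hC _) (abs_nonneg _)
    · have := (c1.abs.mul_const C).tendsto p
      simpa [h0] using this
  · unfold HH condMean
    exact c1.continuousAt.mul (hu.continuousAt.comp (c2.continuousAt.div c1.continuousAt h0))

lemma refine_strict {f u : ℝ → ℝ} (hc : Continuous f) (hp : ∀ t ∈ Icc (0:ℝ) 1, 0 < f t)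
    (hu : ConvexOn ℝ (Icc (0:ℝ) 1) u) (N : ℕ) (a b : ℝ) (ha : 0 ≤ a) (hab : a < b) (hb : b ≤ 1)
    (s : ℕ → ℝ) (h0 : s 0 = a) (h1 : s (N+1) = b) (hm : ∀ k < N+1, s k ≤ s (k+1)) :
    ∃ s' : ℕ → ℝ, s' 0 = a ∧ s' (N+1) = b ∧ (∀ k < N+1, s' k < s' (k+1)) ∧
      WW f u (N+1) s ≤ WW f u (N+1) s' := by
  induction N generalizing a b s with
  | zero =>
    refine ⟨s, h0, h1, ?_, le_rfl⟩
    intro k hk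
    obtain rfl : k = 0 := by omega
    simpa [h0, h1] using hab
  | succ N ih =>
    have mono : ∀ k ≤ N + 1, a ≤ s k := by
      intro k
      induction k with
      | zero => intro _; exact h0.ge
      | succ k ihk => intro hk; exact (ihk (by omega)).trans (hm k (by omega))
    -- appending an endpoint
    have append : ∀ (c b' : ℝ) (t : ℕ → ℝ), t 0 = a → t (N+1) = c → (∀ k < N+1, t k < t (k+1)) →
        c < b' → ∃ s' : ℕ → ℝ, s' 0 = a ∧ s' (N+1+1) = b' ∧ (∀ k < N+1+1, s' k < s' (k+1)) ∧
          WW f u (N+1+1) s' = WW f u (N+1) t + HH f u c b' := by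
      intro c b' t t0 t1 ht hcb
      refine ⟨fun k => if k ≤ N+1 then t k else b', by simp [t0], by simp, ?_, ?_⟩
      · intro k hk
        rcases Nat.lt_succ_iff_lt_or_eq.mp hk with h | h
        · simpa [h.le, Nat.succ_le_of_lt h] using ht k h
        · simp [h, t1, hcb]
      · unfold WW
        rw [Finset.sum_range_succ]
        congr 1
        · apply Finset.sum_congr rfl
          intro k hk
          have hk := Finset.mem_range.mp hk
          have h1 : k ≤ N+1 := hk.le
          have h2 : k+1 ≤ N+1 := hk
          simp only [h1, h2, if_true]
        · simp [t1]
    have hWs : WW f u (N+1+1) s = WW f u (N+1) s + HH f u (s (N+1)) b := by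
      rw [WW, Finset.sum_range_succ, h1]; rfl
    have hsb : s (N+1) ≤ b := h1 ▸ hm (N+1) (by omega)
    rcases (mono (N+1) le_rfl).eq_or_lt with hl | hl
    · -- everything before is degenerate
      have hz : WW f u (N+1) s = 0 := by
        apply Finset.sum_eq_zero
        intro k hk
        have hk := Finset.mem_range.mp hk
        have up : ∀ j ≤ N+1, ∀ d, j + d = N+1 → s j ≤ s (N+1) := by
          intro j hj d
          induction d generalizing j with
          | zero => intro h; rw [show j = N+1 by omega]
          | succ d ihd => intro h; exact (hm j (by omega)).trans (ihd (j+1) (by omega) (by omega))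
        have e1 : s k = a := le_antisymm ((up k hk.le _ (Nat.add_sub_cancel' hk.le)).trans hl.ge) (mono k hk.le)
        have e2 : s (k+1) = a := le_antisymm ((up (k+1) hk _ (Nat.add_sub_cancel' hk)).trans hl.ge) (mono (k+1) hk)
        rw [e1, e2, HH_self]
      set c := (a+b)/2 with hcdef
      have hac : a < c := by rw [hcdef]; linarith
      have hcb : c < b := by rw [hcdef]; linarith
      obtain ⟨t, t0, t1, ht, hW⟩ := ih a c ha hac (hcb.le.trans hb)
        (fun k => if k ≤ N then a else c) (by simp) (by simp) (by
          intro k hk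
          have : k ≤ N := by omega
          simp only [this, if_true]
          split_ifs
          · exact le_rfl
          · exact hac.le)
      have hW' : WW f u (N+1) (fun k => if k ≤ N then a else c) = HH f u a c := by
        rw [WW, Finset.sum_range_succ, Finset.sum_eq_zero]
        · simp
        · intro k hk
          have hk := Finset.mem_range.mp hk
          have h1 : k ≤ N := hk.le
          have h2 : k+1 ≤ N := hk
          simp only [h1, h2, if_true, HH_self]
      obtain ⟨s', a0, a1, a2, a3⟩ := append c b t t0 t1 ht hcb
      refine ⟨s', a0, a1, a2, ?_⟩
      rw [hWs, hz, ← hl, a3]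
      have := HH_split hc hp hu ha hac hcb hb
      linarith
    · rcases hsb.eq_or_lt with hr | hr
      · obtain ⟨t, t0, t1, ht, hW⟩ := ih a b ha hab hb s h0 hr (fun k hk => hm k (by omega))
        have htN : t N < b := t1 ▸ ht N (by omega)
        have hta : ∀ k ≤ N, a ≤ t k := by
          intro k
          induction k with
          | zero => intro _; exact t0.ge
          | succ k ihk => intro hk; exact (ihk (by omega)).trans (ht k (by omega)).le
        set c := (t N+b)/2 with hcdef
        have hac : t N < c := by rw [hcdef]; linarith
        have hcb : c < b := by rw [hcdef]; linarith
        obtain ⟨s', a0, a1, a2, a3⟩ := append c b (fun k => if k ≤ N then t k else c)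
          (by simp [t0]) (by simp) (by
            intro k hk
            rcases Nat.lt_succ_iff_lt_or_eq.mp hk with h | h
            · simpa [h.le, Nat.succ_le_of_lt h] using ht k (by omega)
            · simp [h, hac]) hcb
        refine ⟨s', a0, a1, a2, ?_⟩
        rw [hWs, hr, HH_self, a3]
        have e1 : WW f u (N+1) (fun k => if k ≤ N then t k else c) = WW f u N t + HH f u (t N) c := by
          rw [WW, Finset.sum_range_succ]
          congr 1
          · apply Finset.sum_congr rfl
            intro k hk
            have hk := Finset.mem_range.mp hk
            have h1 : k ≤ N := hk.le
            have h2 : k+1 ≤ N := hk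
            simp only [h1, h2, if_true]
          · simp
        have e2 : WW f u (N+1) t = WW f u N t + HH f u (t N) b := by
          rw [WW, Finset.sum_range_succ, t1]; rfl
        have := HH_split hc hp hu (ha.trans (hta N le_rfl)) hac hcb hb
        linarith
      · obtain ⟨t, t0, t1, ht, hW⟩ := ih a (s (N+1)) ha hl (hr.le.trans hb) s h0 rfl (fun k hk => hm k (by omega))
        obtain ⟨s', a0, a1, a2, a3⟩ := append _ b t t0 t1 ht hr
        exact ⟨s', a0, a1, a2, by rw [hWs, a3]; linarith⟩

lemma exists_max {f u : ℝ → ℝ} (hc : Continuous f) (hu : Continuous u) {C : ℝ}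
    (hC : ∀ t, |u t| ≤ C) (N : ℕ) :
    ∃ s : ℕ → ℝ, s 0 = 0 ∧ s (N+1) = 1 ∧ (∀ k < N+1, s k ≤ s (k+1)) ∧
      ∀ t : ℕ → ℝ, t 0 = 0 → t (N+1) = 1 → (∀ k < N+1, t k ≤ t (k+1)) →
        (∀ k, t k ∈ Icc (0:ℝ) 1) → WW f u (N+1) t ≤ WW f u (N+1) s := by
  have hK : IsCompact ((Set.univ.pi fun _ : ℕ => Icc (0:ℝ) 1) ∩
      {s | s 0 = 0 ∧ s (N+1) = 1 ∧ ∀ k < N+1, s k ≤ s (k+1)}) := by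
    apply (isCompact_univ_pi fun _ => isCompact_Icc).inter_right
    refine (isClosed_eq (continuous_apply _) continuous_const).inter
      ((isClosed_eq (continuous_apply _) continuous_const).inter ?_)
    have : {s : ℕ → ℝ | ∀ k < N+1, s k ≤ s (k+1)} = ⋂ k, ⋂ (_ : k < N+1), {s | s k ≤ s (k+1)} := by
      ext s; simp
    change IsClosed {s : ℕ → ℝ | ∀ k < N+1, s k ≤ s (k+1)}
    rw [this]
    exact isClosed_iInter fun k => isClosed_iInter fun _ =>
      isClosed_le (continuous_apply _) (continuous_apply _)
  have hW : Continuous (WW f u (N+1)) := by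
    unfold WW
    apply continuous_finsetSum
    intro k _
    have h2 : Continuous fun s : ℕ → ℝ => (s k, s (k+1)) :=
      (continuous_apply k).prodMk (continuous_apply (k+1))
    exact (HH_cont hc hu hC).comp h2
  obtain ⟨s, hs, hmax⟩ := hK.exists_isMaxOn ⟨fun k => if k = 0 then 0 else 1, by
    refine ⟨?_, by simp, by simp, ?_⟩
    · intro k _
      dsimp only
      split_ifs <;> simp
    · intro k _
      dsimp only
      split_ifs <;> simp_all⟩ hW.continuousOn
  exact ⟨s, hs.2.1, hs.2.2.1, hs.2.2.2, fun t t0 t1 t2 t3 => hmax ⟨fun k _ => t3 k, t0, t1, t2⟩⟩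

lemma ae_Icc {μ : Measure ℝ} (hs : μ ((Icc (0:ℝ) 1)ᶜ) = 0) : ∀ᵐ t ∂μ, t ∈ Icc (0:ℝ) 1 := hs

lemma integrable_of_cont {μ : Measure ℝ} [IsProbabilityMeasure μ] (hs : μ ((Icc (0:ℝ) 1)ᶜ) = 0)
    {g : ℝ → ℝ} (hg : Continuous g) : Integrable g μ := by
  obtain ⟨C, hC⟩ := isCompact_Icc.exists_bound_of_continuousOn (s := Icc (0:ℝ) 1) hg.continuousOn
  exact Integrable.of_bound hg.aestronglyMeasurable C ((ae_Icc hs).mono fun t ht => hC t ht)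

lemma hinge {μ : Measure ℝ} [IsProbabilityMeasure μ] (hs : μ ((Icc (0:ℝ) 1)ᶜ) = 0) {b : ℝ}
    (hb : 0 ≤ b) : ∫ t in (0:ℝ)..b, (μ (Iic t)).toReal = ∫ s, max (b - s) 0 ∂μ := by
  have hi : Integrable (fun s => max (b - s) 0) μ := integrable_of_cont hs (by fun_prop)
  rw [hi.integral_eq_integral_Ioc_meas_le (M := b) (Filter.Eventually.of_forall fun s => le_max_right _ _)
    ((ae_Icc hs).mono fun t ht => max_le (by linarith [ht.1]) hb),
    ← intervalIntegral.integral_of_le hb]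
  have := intervalIntegral.integral_comp_sub_left (a := 0) (b := b) (fun t => (μ (Iic t)).toReal) b
  simp only [sub_self, sub_zero] at this
  rw [← this]
  apply intervalIntegral.integral_congr_ae
  filter_upwards with t ht
  rw [uIoc_of_le hb] at ht
  rw [Measure.real]
  congr 2
  ext s
  simp only [mem_Iic, mem_ofPred_eq, le_max_iff]
  constructor
  · intro h; left; linarith
  · rintro (h | h)
    · linarith
    · linarith [ht.1]

lemma dens_integral {f : ℝ → ℝ} (hc : Continuous f) (hp : ∀ t ∈ Icc (0:ℝ) 1, 0 < f t)
    (g : ℝ → ℝ) : ∫ t, g t ∂(densityMeasure f) = ∫ t in (0:ℝ)..1, f t * g t := by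
  unfold densityMeasure
  rw [integral_withDensity_eq_integral_toReal_smul (by fun_prop) (by simp),
    intervalIntegral.integral_of_le zero_le_one, ← integral_Icc_eq_integral_Ioc]
  apply setIntegral_congr_fun measurableSet_Icc
  intro t ht
  simp [ENNReal.toReal_ofReal (hp t ht).le]

lemma dens_Ioc {f : ℝ → ℝ} (hc : Continuous f) (hp : ∀ t ∈ Icc (0:ℝ) 1, 0 < f t)
    {a b : ℝ} (ha : 0 ≤ a) (hab : a ≤ b) (hb : b ≤ 1) :
    densityMeasure f (Ioc a b) = ENNReal.ofReal (∫ t in a..b, f t) := by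
  have hsub : Ioc a b ⊆ Icc 0 1 := fun t ht => ⟨ha.trans ht.1.le, ht.2.trans hb⟩
  unfold densityMeasure
  rw [withDensity_apply _ measurableSet_Ioc, Measure.restrict_restrict measurableSet_Ioc,
    inter_eq_left.mpr hsub, intervalIntegral.integral_of_le hab, ofReal_integral_eq_lintegral_ofReal]
  · exact (hc.integrableOn_Icc).mono_set Ioc_subset_Icc_self
  · filter_upwards [ae_restrict_mem measurableSet_Ioc] with t ht
    exact (hp t (hsub ht)).le

lemma dens_compl (f : ℝ → ℝ) : densityMeasure f ((Icc (0:ℝ) 1)ᶜ) = 0 := by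
  apply withDensity_absolutelyContinuous
  rw [Measure.restrict_apply measurableSet_Icc.compl]; simp

lemma dens_prob {f : ℝ → ℝ} (hc : Continuous f) (hp : ∀ t ∈ Icc (0:ℝ) 1, 0 < f t)
    (h1 : (∫ t in (0:ℝ)..1, f t) = 1) : IsProbabilityMeasure (densityMeasure f) := by
  constructor
  unfold densityMeasure
  rw [withDensity_apply _ MeasurableSet.univ, Measure.restrict_univ,
    ← ofReal_integral_eq_lintegral_ofReal, integral_Icc_eq_integral_Ioc,
    ← intervalIntegral.integral_of_le zero_le_one, h1, ENNReal.ofReal_one]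
  · exact hc.integrableOn_Icc
  · filter_upwards [ae_restrict_mem measurableSet_Icc] with t ht
    exact (hp t ht).le

lemma hinge_le {ν G : Measure ℝ} [IsProbabilityMeasure ν] [IsProbabilityMeasure G]
    (hν : ν ((Icc (0:ℝ) 1)ᶜ) = 0) (hG : G ((Icc (0:ℝ) 1)ᶜ) = 0) (h : IsMPCof ν G) {b : ℝ}
    (hb : b ∈ Icc (0:ℝ) 1) :
    ∫ t, max (b - t) 0 ∂G ≤ ∫ t, max (b - t) 0 ∂ν := by
  rw [← hinge hG hb.1, ← hinge hν hb.1]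
  exact h.2 b hb

lemma hinge_le' {ν G : Measure ℝ} [IsProbabilityMeasure ν] [IsProbabilityMeasure G]
    (hν : ν ((Icc (0:ℝ) 1)ᶜ) = 0) (hG : G ((Icc (0:ℝ) 1)ᶜ) = 0) (h : IsMPCof ν G) {b : ℝ}
    (hb : b ∈ Icc (0:ℝ) 1) :
    ∫ t, max (t - b) 0 ∂G ≤ ∫ t, max (t - b) 0 ∂ν := by
  have key : ∀ μ : Measure ℝ, IsProbabilityMeasure μ → μ ((Icc (0:ℝ) 1)ᶜ) = 0 →
      ∫ t, max (t - b) 0 ∂μ = ∫ t, max (b - t) 0 ∂μ + ((∫ t, t ∂μ) - b) := by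
    intro μ hμ hs
    have i1 : Integrable (fun t : ℝ => max (b - t) 0) μ := integrable_of_cont hs (by fun_prop)
    have i2 : Integrable (fun t : ℝ => t) μ := integrable_of_cont hs (by fun_prop)
    have : (fun t : ℝ => max (t - b) 0) = fun t => max (b - t) 0 + (t - b) := by
      ext t
      rcases le_total t b with h | h
      · rw [max_eq_right (by linarith), max_eq_left (by linarith)]; ring
      · rw [max_eq_left (by linarith), max_eq_right (by linarith)]; ring
    rw [this, integral_add i1 (integrable_of_cont hs (by fun_prop)), integral_sub i2 (integrable_const _)]
    simp
  rw [key G inferInstance hG, key ν inferInstance hν, h.1]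
  linarith [hinge_le hν hG h hb]

/-- abstract: an atom lower-bounds the integral of a nonnegative function -/
lemma atom_le {G : Measure ℝ} [IsProbabilityMeasure G] (hG : G ((Icc (0:ℝ) 1)ᶜ) = 0)
    {g : ℝ → ℝ} (hg : Continuous g) (hn : ∀ t, 0 ≤ g t) (x : ℝ) :
    G.real {x} * g x ≤ ∫ t, g t ∂G := by
  have h := setIntegral_le_integral (s := {x}) (integrable_of_cont hG hg) (Filter.Eventually.of_forall hn)
  rwa [integral_singleton, smul_eq_mul] at h

lemma no_atom0 {f : ℝ → ℝ} (hc : Continuous f) (hp : ∀ t ∈ Icc (0:ℝ) 1, 0 < f t)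
    (h1 : (∫ t in (0:ℝ)..1, f t) = 1) {G : Measure ℝ} [IsProbabilityMeasure G]
    (hG : G ((Icc (0:ℝ) 1)ᶜ) = 0) (h : IsMPCof (densityMeasure f) G) : G {0} = 0 := by
  have := dens_prob hc hp h1
  have hle : ∀ x ∈ Ioo (0:ℝ) 1, G.real {0} ≤ ∫ t in (0:ℝ)..x, f t := by
    intro x hx
    have a1 := atom_le hG (g := fun t => max (x - t) 0) (by fun_prop) (fun t => le_max_right _ _) 0
    have a2 := hinge_le (dens_compl f) hG h ⟨hx.1.le, hx.2.le⟩
    have a3 : ∫ t, max (x - t) 0 ∂(densityMeasure f) ≤ x * ∫ t in (0:ℝ)..x, f t := by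
      have ci : Continuous fun t => f t * max (x - t) 0 := by fun_prop
      rw [dens_integral hc hp, ← intervalIntegral.integral_add_adjacent_intervals
        (ci.intervalIntegrable 0 x) (ci.intervalIntegrable x 1)]
      have z : ∫ t in x..1, f t * max (x - t) 0 = 0 := by
        rw [intervalIntegral.integral_congr (g := fun _ => (0:ℝ))]
        · simp
        · intro t ht
          rw [uIcc_of_le hx.2.le] at ht
          simp [max_eq_right (sub_nonpos.mpr ht.1)]
      rw [z, add_zero, ← intervalIntegral.integral_const_mul]
      apply intervalIntegral.integral_mono_on hx.1.le (ci.intervalIntegrable _ _)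
        ((by fun_prop : Continuous fun t => x * f t).intervalIntegrable _ _)
      intro t ht
      rw [mul_comm]
      exact mul_le_mul_of_nonneg_right (max_le (by linarith [ht.1]) hx.1.le)
        (hp t ⟨ht.1, ht.2.trans hx.2.le⟩).le
    simp only [sub_zero, max_eq_left hx.1.le] at a1
    have := a1.trans (a2.trans a3)
    rw [mul_comm] at this
    exact le_of_mul_le_mul_left this hx.1
  have hcont := intervalIntegral.continuous_primitive (μ := volume) (fun a b => hc.intervalIntegrable a b) 0
  have ht : Filter.Tendsto (fun x => ∫ t in (0:ℝ)..x, f t) (nhdsWithin 0 (Ioi 0)) (nhds 0) := by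
    have := (hcont.tendsto 0).mono_left (nhdsWithin_le_nhds (s := Ioi (0:ℝ)))
    simpa using this
  have := ge_of_tendsto ht (Filter.eventually_of_mem (Ioo_mem_nhdsGT one_pos) hle)
  have h0 : G.real {0} = 0 := le_antisymm this measureReal_nonneg
  simpa [Measure.real, ENNReal.toReal_eq_zero_iff] using h0

lemma no_atom1 {f : ℝ → ℝ} (hc : Continuous f) (hp : ∀ t ∈ Icc (0:ℝ) 1, 0 < f t)
    (h1 : (∫ t in (0:ℝ)..1, f t) = 1) {G : Measure ℝ} [IsProbabilityMeasure G]
    (hG : G ((Icc (0:ℝ) 1)ᶜ) = 0) (h : IsMPCof (densityMeasure f) G) : G {1} = 0 := by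
  have := dens_prob hc hp h1
  have hle : ∀ x ∈ Ioo (0:ℝ) 1, G.real {1} ≤ ∫ t in x..1, f t := by
    intro x hx
    have a1 := atom_le hG (g := fun t => max (t - x) 0) (by fun_prop) (fun t => le_max_right _ _) 1
    have a2 := hinge_le' (dens_compl f) hG h ⟨hx.1.le, hx.2.le⟩
    have hx1 : 0 < 1 - x := by linarith [hx.2]
    have a3 : ∫ t, max (t - x) 0 ∂(densityMeasure f) ≤ (1 - x) * ∫ t in x..1, f t := by
      have ci : Continuous fun t => f t * max (t - x) 0 := by fun_prop
      rw [dens_integral hc hp, ← intervalIntegral.integral_add_adjacent_intervals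
        (ci.intervalIntegrable 0 x) (ci.intervalIntegrable x 1)]
      have z : ∫ t in (0:ℝ)..x, f t * max (t - x) 0 = 0 := by
        rw [intervalIntegral.integral_congr (g := fun _ => (0:ℝ))]
        · simp
        · intro t ht
          rw [uIcc_of_le hx.1.le] at ht
          simp [max_eq_right (sub_nonpos.mpr ht.2)]
      rw [z, zero_add, ← intervalIntegral.integral_const_mul]
      apply intervalIntegral.integral_mono_on hx.2.le (ci.intervalIntegrable _ _)
        ((by fun_prop : Continuous fun t => (1 - x) * f t).intervalIntegrable _ _)
      intro t ht
      rw [mul_comm]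
      exact mul_le_mul_of_nonneg_right (max_le (by linarith [ht.2]) hx1.le)
        (hp t ⟨hx.1.le.trans ht.1, ht.2⟩).le
    simp only [max_eq_left hx1.le] at a1
    have := a1.trans (a2.trans a3)
    rw [mul_comm] at this
    exact le_of_mul_le_mul_left this hx1
  have hcont := intervalIntegral.continuous_primitive (μ := volume) (fun a b => hc.intervalIntegrable a b) 1
  have ht : Filter.Tendsto (fun x => ∫ t in x..1, f t) (nhdsWithin 1 (Iio 1)) (nhds 0) := by
    have := ((hcont.tendsto 1).mono_left (nhdsWithin_le_nhds (s := Iio (1:ℝ)))).neg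
    simpa [← intervalIntegral.integral_symm] using this
  have := ge_of_tendsto ht (Filter.eventually_of_mem (Ioo_mem_nhdsLT one_pos) hle)
  have h0 : G.real {1} = 0 := le_antisymm this measureReal_nonneg
  simpa [Measure.real, ENNReal.toReal_eq_zero_iff] using h0

lemma exists_subgrad {u : ℝ → ℝ} (hu : ConvexOn ℝ (Icc (0:ℝ) 1) u) :
    ∃ α : ℝ → ℝ, ∀ x ∈ Ioo (0:ℝ) 1, ∀ y ∈ Icc (0:ℝ) 1, u x + α x * (y - x) ≤ u y := by
  refine ⟨fun x => derivWithin u (Ioi x) x, fun x hx y hy => ?_⟩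
  have hxi : x ∈ interior (Icc (0:ℝ) 1) := by rwa [interior_Icc]
  rcases lt_trichotomy x y with h | h | h
  · have := hu.rightDeriv_le_slope_of_mem_interior hxi hy h
    rw [slope_def_field, le_div_iff₀ (by linarith)] at this
    linarith
  · simp [h]
  · have := (hu.slope_le_leftDeriv_of_mem_interior hy hxi h).trans
      (hu.leftDeriv_le_rightDeriv_of_mem_interior hxi)
    rw [slope_def_field, div_le_iff₀ (by linarith)] at this
    linarith

lemma dominate {f u : ℝ → ℝ} (hc : Continuous f) (hp : ∀ t ∈ Icc (0:ℝ) 1, 0 < f t)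
    (h1 : (∫ t in (0:ℝ)..1, f t) = 1) (hu : ConvexOn ℝ (Icc (0:ℝ) 1) u) (N : ℕ)
    {G : Measure ℝ} [IsProbabilityMeasure G]
    (hG : G ((Icc (0:ℝ) 1)ᶜ) = 0) (h : IsMPCof (densityMeasure f) G)
    (x : ℕ → ℝ) (hx : ∀ k, x k ∈ Ioo (0:ℝ) 1) (hmono : ∀ k, x k ≤ x (k+1))
    (hsupp : ∀ᵐ t ∂G, ∃ k ≤ N, t = x k) :
    ∃ s : ℕ → ℝ, s 0 = 0 ∧ s (N+1) = 1 ∧ (∀ k < N+1, s k ≤ s (k+1)) ∧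
        (∀ k, s k ∈ Icc (0:ℝ) 1) ∧ ∫ t, u t ∂G ≤ WW f u (N+1) s := by
  have := dens_prob hc hp h1
  obtain ⟨α, hα⟩ := exists_subgrad hu
  set l : ℕ → ℝ → ℝ := fun k t => u (x k) + α (x k) * (t - x k) with hl
  have hxI : ∀ k, x k ∈ Icc (0:ℝ) 1 := fun k => ⟨(hx k).1.le, (hx k).2.le⟩
  have hβ : ∀ k, ∃ β ∈ Icc (x k) (x (k+1)), l k β = l (k+1) β := by
    intro k
    have hcon : ContinuousOn (fun t => l k t - l (k+1) t) (Icc (x k) (x (k+1))) := by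
      simp only [hl]; fun_prop
    have := intermediate_value_Icc' (hmono k) hcon
    obtain ⟨β, hβ, e⟩ := this (show (0:ℝ) ∈ _ by
      constructor
      · have := hα (x k) (hx k) (x (k+1)) (hxI _)
        simp only [hl]; linarith
      · have := hα (x (k+1)) (hx _) (x k) (hxI _)
        simp only [hl]; linarith)
    exact ⟨β, hβ, sub_eq_zero.mp e⟩
  choose β hβm hβe using hβ
  have hβI : ∀ k, β k ∈ Icc (0:ℝ) 1 := fun k =>
    ⟨(hxI k).1.trans (hβm k).1, (hβm k).2.trans (hxI (k+1)).2⟩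
  have hβmono : Monotone β := monotone_nat_of_le_succ fun k => (hβm k).2.trans (hβm (k+1)).1
  have hαmono : ∀ k, 0 ≤ α (x (k+1)) - α (x k) := by
    intro k
    have e1 := hα (x k) (hx k) (x (k+1)) (hxI _)
    have e2 := hα (x (k+1)) (hx _) (x k) (hxI _)
    rcases (hmono k).eq_or_lt with h | h
    · rw [h]; simp
    · by_contra hcon
      push Not at hcon
      nlinarith
  have hdiff : ∀ k t, (α (x (k+1)) - α (x k)) * (t - β k) = l (k+1) t - l k t := by
    intro k t
    have := hβe k
    simp only [hl] at this ⊢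
    linarith
  set s : ℕ → ℝ := fun k => if k = 0 then 0 else if k ≤ N then β (k-1) else 1 with hs
  set v : ℝ → ℝ := fun t => l 0 t + ∑ i ∈ Finset.range N, (α (x (i+1)) - α (x i)) * max (t - β i) 0 with hv
  have hvl : ∀ k ≤ N, ∀ t, (∀ i < k, β i ≤ t) → (∀ i, k ≤ i → i < N → t ≤ β i) → v t = l k t := by
    intro k hk t hlo hhi
    have : ∀ n ≤ N, l 0 t + ∑ i ∈ Finset.range n, (α (x (i+1)) - α (x i)) * max (t - β i) 0
        = l (min n k) t := by
      intro n
      induction n with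
      | zero => intro _; simp
      | succ n ih =>
        intro hn
        rw [Finset.sum_range_succ, ← add_assoc, ih (by omega)]
        rcases lt_or_ge n k with hnk | hnk
        · rw [max_eq_left (sub_nonneg.mpr (hlo n hnk)), hdiff, min_eq_left hnk.le,
            min_eq_left (Nat.succ_le_of_lt hnk)]; ring
        · rw [max_eq_right (sub_nonpos.mpr (hhi n hnk (by omega))), min_eq_right hnk,
            min_eq_right (by omega)]; ring
    have := this N le_rfl
    rw [min_eq_right hk] at this
    exact this
  have hsI : ∀ k, s k ∈ Icc (0:ℝ) 1 := by
    intro k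
    simp only [hs]
    split_ifs
    · simp
    · exact hβI _
    · simp
  have hsm : ∀ k < N+1, s k ≤ s (k+1) := by
    intro k hk
    rcases Nat.eq_zero_or_pos k with h0 | h0
    · have : s k = 0 := by simp [hs, h0]
      rw [this]; exact (hsI _).1
    · by_cases hkN : k + 1 ≤ N
      · have e1 : s k = β (k-1) := by simp only [hs]; rw [if_neg (by omega), if_pos (by omega)]
        have e2 : s (k+1) = β k := by
          simp only [hs]; rw [if_neg (by omega), if_pos (by omega), Nat.add_sub_cancel]
        rw [e1, e2]; exact hβmono (by omega)
      · have e2 : s (k+1) = 1 := by simp only [hs]; rw [if_neg (by omega), if_neg (by omega)]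
        rw [e2]; exact (hsI _).2
  have hvs : ∀ k ≤ N, ∀ t, s k ≤ t → t ≤ s (k+1) → v t = l k t := by
    intro k hk t ht1 ht2
    apply hvl k hk t
    · intro i hi
      have e1 : s k = β (k-1) := by simp only [hs]; rw [if_neg (by omega), if_pos (by omega)]
      rw [e1] at ht1
      exact (hβmono (by omega)).trans ht1
    · intro i hi hiN
      have e2 : s (k+1) = β k := by
        simp only [hs]; rw [if_neg (by omega), if_pos (by omega), Nat.add_sub_cancel]
      rw [e2] at ht2
      exact ht2.trans (hβmono hi)
  have hvx : ∀ k ≤ N, v (x k) = u (x k) := by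
    intro k hk
    rw [hvl k hk (x k)]
    · simp [hl]
    · intro i hi
      exact (hβm i).2.trans (monotone_nat_of_le_succ hmono (by omega))
    · intro i hi _
      exact (monotone_nat_of_le_succ hmono hi).trans (hβm i).1
  have hvc : Continuous v := by simp only [hv, hl]; fun_prop
  have hs0 : s 0 = 0 := by simp [hs]
  have hs1 : s (N+1) = 1 := by simp [hs]
  refine ⟨s, hs0, hs1, hsm, hsI, ?_⟩
  -- integral of v
  have key : ∀ μ : Measure ℝ, IsProbabilityMeasure μ → μ ((Icc (0:ℝ) 1)ᶜ) = 0 →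
      ∫ t, v t ∂μ = u (x 0) + α (x 0) * ((∫ t, t ∂μ) - x 0) +
        ∑ i ∈ Finset.range N, (α (x (i+1)) - α (x i)) * ∫ t, max (t - β i) 0 ∂μ := by
    intro μ hμ hsμ
    have i2 : Integrable (fun t : ℝ => t) μ := integrable_of_cont hsμ (by fun_prop)
    simp only [hv, hl]
    rw [integral_add (integrable_of_cont hsμ (by fun_prop)) (integrable_of_cont hsμ (by fun_prop)),
      integral_add (integrable_const _) (integrable_of_cont hsμ (by fun_prop)),
      integral_const_mul, integral_sub i2 (integrable_const _),
      integral_finsetSum _ (fun i _ => integrable_of_cont hsμ (by fun_prop))]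
    simp [integral_const_mul]
  calc ∫ t, u t ∂G = ∫ t, v t ∂G := by
        apply integral_congr_ae
        filter_upwards [hsupp] with t ht
        obtain ⟨k, hk, rfl⟩ := ht
        exact (hvx k hk).symm
    _ ≤ ∫ t, v t ∂(densityMeasure f) := by
        rw [key G inferInstance hG, key _ inferInstance (dens_compl f), h.1]
        refine add_le_add le_rfl (Finset.sum_le_sum fun i hi => ?_)
        exact mul_le_mul_of_nonneg_left (hinge_le' (dens_compl f) hG h (hβI i)) (hαmono i)
    _ = ∑ k ∈ Finset.range (N+1), ∫ t in s k..s (k+1), f t * v t := by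
        rw [dens_integral hc hp, intervalIntegral.sum_integral_adjacent_intervals
          (f := fun t => f t * v t) (fun k _ => (hc.mul hvc).intervalIntegrable _ _), hs0, hs1]
    _ ≤ _ := by
        unfold WW
        apply Finset.sum_le_sum
        intro k hk
        have hk := Finset.mem_range.mp hk
        rcases (hsm k hk).eq_or_lt with he | hlt
        · rw [← he, HH_self, intervalIntegral.integral_same]
        have hM := M_pos hc hp (hsI k).1 hlt (hsI (k+1)).2
        have hm := condMean_mem hc hp (hsI k).1 hlt (hsI (k+1)).2
        have e : ∫ t in s k..s (k+1), f t * v t =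
            ∫ t in s k..s (k+1), ((u (x k) - α (x k) * x k) * f t + α (x k) * (t * f t)) := by
          apply intervalIntegral.integral_congr
          intro t ht
          rw [uIcc_of_le hlt.le] at ht
          simp only
          rw [hvs k (by omega) t ht.1 ht.2]
          simp only [hl]; ring
        rw [e, intervalIntegral.integral_add
          ((by fun_prop : Continuous fun t => (u (x k) - α (x k) * x k) * f t).intervalIntegrable _ _)
          ((by fun_prop : Continuous fun t => α (x k) * (t * f t)).intervalIntegrable _ _),
          intervalIntegral.integral_const_mul, intervalIntegral.integral_const_mul]
        have e2 : ∫ t in s k..s (k+1), t * f t = (∫ t in s k..s (k+1), f t) * condMean f (s k) (s (k+1)) := by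
          unfold condMean; field_simp
        rw [e2, HH]
        have := hα (x k) (hx k) (condMean f (s k) (s (k+1)))
          ⟨(hsI k).1.trans hm.1, hm.2.trans (hsI (k+1)).2⟩
        have := mul_le_mul_of_nonneg_left this hM.le
        linarith

lemma core {f u : ℝ → ℝ} (hc : Continuous f) (hp : ∀ t ∈ Icc (0:ℝ) 1, 0 < f t)
    (h1 : (∫ t in (0:ℝ)..1, f t) = 1) (hu : ConvexOn ℝ (Icc (0:ℝ) 1) u) (huc : Continuous u)
    {C : ℝ} (hC : ∀ t, |u t| ≤ C) (N : ℕ) :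
    ∃ s : ℕ → ℝ, s 0 = 0 ∧ s (N+1) = 1 ∧ (∀ k < N+1, s k < s (k + 1)) ∧
      ∀ G : Measure ℝ, IsProbabilityMeasure G → G ((Icc (0:ℝ) 1)ᶜ) = 0 →
        IsMPCof (densityMeasure f) G → FiniteSupportLE G (N+1) →
        (∫ t, u t ∂G) ≤ WW f u (N+1) s := by
  obtain ⟨s, s0, s1, sm, smax⟩ := exists_max hc huc hC N
  obtain ⟨s', a0, a1, a2, a3⟩ := refine_strict hc hp hu N 0 1 le_rfl one_pos le_rfl s s0 s1 sm
  refine ⟨s', a0, a1, a2, ?_⟩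
  intro G hGp hG hmpc ⟨S, hScard, hS⟩
  have g0 := no_atom0 hc hp h1 hG hmpc
  have g1 := no_atom1 hc hp h1 hG hmpc
  classical
  set T := S.filter (fun t => t ∈ Ioo (0:ℝ) 1) with hT
  have hTae : ∀ᵐ t ∂G, t ∈ T := by
    have hS' : ∀ᵐ t ∂G, t ∈ (S : Set ℝ) := hS
    have h0 : ∀ᵐ t ∂G, t ∉ ({0} : Set ℝ) := measure_eq_zero_iff_ae_notMem.mp g0
    have h1 : ∀ᵐ t ∂G, t ∉ ({1} : Set ℝ) := measure_eq_zero_iff_ae_notMem.mp g1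
    filter_upwards [hS', ae_Icc hG, h0, h1] with t t1 t2 t3 t4
    rw [hT, Finset.mem_filter]
    exact ⟨t1, lt_of_le_of_ne t2.1 (Ne.symm t3), lt_of_le_of_ne t2.2 t4⟩
  have hTcard : T.card ≤ N+1 := (Finset.card_filter_le _ _).trans hScard
  have hTpos : 0 < T.card := by
    obtain ⟨t, ht⟩ := hTae.exists
    exact Finset.card_pos.mpr ⟨t, ht⟩
  set e := T.orderEmbOfFin rfl with he
  set x : ℕ → ℝ := fun k => e ⟨min k (T.card - 1), by omega⟩ with hxdef
  obtain ⟨t, t0, t1, tm, tI, tW⟩ := dominate hc hp h1 hu N hG hmpc x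
    (fun k => (Finset.mem_filter.mp (T.orderEmbOfFin_mem rfl _)).2)
    (fun k => e.monotone (by simp only [Fin.mk_le_mk]; omega))
    (by
      filter_upwards [hTae] with t ht
      have : t ∈ Set.range e := by rw [he, Finset.range_orderEmbOfFin]; exact ht
      obtain ⟨i, rfl⟩ := this
      refine ⟨i, by omega, ?_⟩
      simp only [hxdef]
      congr 1
      ext
      simp only
      omega)
  exact tW.trans ((smax t t0 t1 tm tI).trans a3)

/-- optimality of an interval-partitional structure for convex value
functions, within the class of mean-preserving contractions with at most `N` support
points. -/
theorem stmt_9 (f u : ℝ → ℝ) (N : ℕ) (hN : 1 ≤ N)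
    (hf_cont : Continuous f) (hf_pos : ∀ t ∈ Icc (0:ℝ) 1, 0 < f t)
    (hf_prob : (∫ t in (0:ℝ)..1, f t) = 1)
    (hu_conv : ConvexOn ℝ (Icc (0:ℝ) 1) u) (hu_cont : ContinuousOn u (Icc (0:ℝ) 1)) :
    ∃ s : ℕ → ℝ, s 0 = 0 ∧ s N = 1 ∧ (∀ k < N, s k < s (k + 1)) ∧
      ∀ G : Measure ℝ, IsProbabilityMeasure G → G ((Icc (0:ℝ) 1)ᶜ) = 0 →
        IsMPCof (densityMeasure f) G → FiniteSupportLE G N →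
        (∫ t, u t ∂G) ≤ ∫ t, u t ∂(intervalPartitionMeasure f N s) := by
  obtain ⟨N, rfl⟩ : ∃ n, N = n + 1 := ⟨N - 1, by omega⟩
  set w : ℝ → ℝ := IccExtend (zero_le_one' ℝ) ((Icc (0:ℝ) 1).domRestrict u) with hw
  have hwu : ∀ t ∈ Icc (0:ℝ) 1, w t = u t := fun t ht => by
    rw [hw, IccExtend_of_mem _ _ ht]; rfl
  have hwc : Continuous w := hu_cont.domRestrict.Icc_extend'
  have hwconv : ConvexOn ℝ (Icc (0:ℝ) 1) w := hu_conv.congr fun t ht => (hwu t ht).symm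
  obtain ⟨C, hC⟩ := isCompact_Icc.exists_bound_of_continuousOn hu_cont
  have hwC : ∀ t, |w t| ≤ C := fun t => hC _ (projIcc (0:ℝ) 1 zero_le_one t).2
  obtain ⟨s, s0, s1, sm, hmax⟩ := core hf_cont hf_pos hf_prob hwconv hwc hwC N
  refine ⟨s, s0, s1, sm, ?_⟩
  intro G hGp hG hmpc hfin
  have hlo : ∀ k ≤ N + 1, 0 ≤ s k := by
    intro k
    induction k with
    | zero => intro _; exact s0.ge
    | succ k ih => intro hk; exact (ih (by omega)).trans (sm k (by omega)).le
  have hhi : ∀ d j, j + d = N + 1 → s j ≤ 1 := by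
    intro d
    induction d with
    | zero => intro j hj; rw [show j = N + 1 by omega, s1]
    | succ d ih => intro j hj; exact (sm j (by omega)).le.trans (ih (j+1) (by omega))
  have hR : ∫ t, u t ∂(intervalPartitionMeasure f (N+1) s) = WW f w (N+1) s := by
    unfold intervalPartitionMeasure
    rw [Measure.sum_fintype, integral_finsetSum_measure, WW, Finset.sum_range]
    · apply Finset.sum_congr rfl
      intro k _
      have hk := k.2
      have b1 := hlo k.val hk.le
      have b2 := hhi (N + 1 - (k.val + 1)) (k.val + 1) (by omega)
      have hm := condMean_mem hf_cont hf_pos b1 (sm k.val hk) b2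
      rw [integral_smul_measure, integral_dirac, dens_Ioc hf_cont hf_pos b1 (sm k.val hk).le b2,
        ENNReal.toReal_ofReal (M_pos hf_cont hf_pos b1 (sm k.val hk) b2).le, HH,
        hwu _ ⟨b1.trans hm.1, hm.2.trans b2⟩, smul_eq_mul]
    · intro k _
      have hk := k.2
      have b1 := hlo k.val hk.le
      have b2 := hhi (N + 1 - (k.val + 1)) (k.val + 1) (by omega)
      apply Integrable.smul_measure
      · exact integrable_dirac (by simp)
      · rw [dens_Ioc hf_cont hf_pos b1 (sm k.val hk).le b2]
        exact ENNReal.ofReal_ne_top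
  rw [hR]
  refine le_trans (le_of_eq ?_) (hmax G hGp hG hmpc hfin)
  apply integral_congr_ae
  filter_upwards [ae_Icc hG] with t ht
  exact (hwu t ht).symm
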